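/- Let R be a supertropical domain and A ∈ M_n(R) with characteristic polynomial f_A = λ^n + Σ_{k=1}^n α_k λ^{n-k}. Then for every m ≥ 1 and every k ∈ {0, 1, …, n}, the coefficient of λ^{n-k} in the characteristic polynomial of A^m ghost-surpasses α_k^m (where α_0 = 1). -/

import Mathlib

/-- A supertropical semiring structure on a commutative semiring `R`, given by the ghost
map `ν`.  The ghost ideal is `Set.range ν`; the tangible elements are those not in it. -/
structure IsSupertropical {R : Type*} [CommSemiring R] (ν : R → R) : Prop where
  idem : ∀ a : R, ν (ν a) = ν a
  addMap : ∀ a b : R, ν (a + b) = ν a + ν b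
  mulMap : ∀ a b : R, ν (a * b) = ν a * ν b
  ghost : ∀ a : R, ν a = a + a
  addEq : ∀ a b : R, ν a = ν b → a + b = ν a
  addNe : ∀ a b : R, ν a ≠ ν b → a + b = a ∨ a + b = b

/-- A supertropical domain: a supertropical semiring in which the tangible elements
`T = R \ ν(R)` form a cancellative multiplicative monoid and `ν` maps `T` onto `ν(R) \ {0}`. -/
structure IsSupertropicalDomain {R : Type*} [CommSemiring R] (ν : R → R)
    extends IsSupertropical ν : Prop where
  oneTangible : (1 : R) ∉ Set.range ν
  mulTangible : ∀ a b : R, a ∉ Set.range ν → b ∉ Set.range ν → a * b ∉ Set.range ν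
  cancelTangible : ∀ a b c : R, a ∉ Set.range ν → b ∉ Set.range ν → c ∉ Set.range ν →
    a * b = a * c → b = c
  onto : ∀ g ∈ Set.range ν, g ≠ 0 → ∃ t ∉ Set.range ν, ν t = g

/-- The supertropical determinant (permanent) of a square matrix. -/
noncomputable def stPer {m : Type*} [Fintype m] [DecidableEq m] {R : Type*} [CommSemiring R]
    (A : Matrix m m R) : R :=
  ∑ σ : Equiv.Perm m, ∏ i, A i (σ i)

/-- The supertropical characteristic polynomial `|λI + A|`: the permanent of `λI + A`
computed in the polynomial semiring `R[λ]`. -/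
noncomputable def stCharPoly {m : Type*} [Fintype m] [DecidableEq m] {R : Type*}
    [CommSemiring R] (A : Matrix m m R) : Polynomial R :=
  ∑ σ : Equiv.Perm m, ∏ i, ((if i = σ i then Polynomial.X else 0) + Polynomial.C (A i (σ i)))

namespace IsSupertropical

variable {R : Type*} [CommSemiring R] {ν : R → R}

theorem map_zero (h : IsSupertropical ν) : ν 0 = 0 := by simp [h.ghost]

theorem add_self_add_self (h : IsSupertropical ν) (a : R) : ν a + ν a = ν a := by
  rw [← h.ghost, h.idem]

theorem add_map_self (h : IsSupertropical ν) (a : R) : a + ν a = ν a := by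
  rw [h.addEq _ _ (h.idem a).symm]

theorem eq_zero_of_map_eq_zero (h : IsSupertropical ν) {a : R} (ha : ν a = 0) : a = 0 := by
  have := h.addEq a 0 (by rw [ha, h.map_zero])
  rwa [add_zero, ha] at this

/-- The ghost ideal `ν(R)`. -/
def ghostIdeal (h : IsSupertropical ν) : Ideal R where
  carrier := Set.range ν
  add_mem' := by
    rintro _ _ ⟨a, rfl⟩ ⟨b, rfl⟩
    exact ⟨a + b, h.addMap a b⟩
  zero_mem' := ⟨0, h.map_zero⟩
  smul_mem' := by
    rintro c _ ⟨a, rfl⟩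
    exact ⟨c * a, by rw [h.ghost, h.ghost, smul_eq_mul, mul_add]⟩

theorem mem_ghostIdeal (h : IsSupertropical ν) {x : R} : x ∈ h.ghostIdeal ↔ x ∈ Set.range ν :=
  Iff.rfl

theorem map_sum (h : IsSupertropical ν) {ι : Type*} (s : Finset ι) (f : ι → R) :
    ν (∑ i ∈ s, f i) = ∑ i ∈ s, ν (f i) := by
  simp only [h.ghost, Finset.sum_add_distrib]

theorem map_pow (h : IsSupertropical ν) (a : R) {m : ℕ} (hm : m ≠ 0) : ν (a ^ m) = ν a ^ m := by
  induction m with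
  | zero => exact absurd rfl hm
  | succ m ih =>
    rcases eq_or_ne m 0 with rfl | hm'
    · simp
    · rw [pow_succ, h.mulMap, ih hm', pow_succ]

/-- A finite sum in which every term is repeated at a different index is a ghost. -/
theorem sum_mem_ghostIdeal (h : IsSupertropical ν) {ι : Type*} (s : Finset ι) (f : ι → R)
    (hf : ∀ i ∈ s, ∃ j ∈ s, j ≠ i ∧ f j = f i) : ∑ i ∈ s, f i ∈ h.ghostIdeal := by
  classical
  have absorb : ∀ i ∈ s, ν (f i) + ∑ j ∈ s, f j = ∑ j ∈ s, f j := by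
    intro i hi
    obtain ⟨j, hj, hji, hfj⟩ := hf i hi
    rw [← Finset.add_sum_erase s f hi,
      ← Finset.add_sum_erase (s.erase i) f (Finset.mem_erase.2 ⟨hji, hj⟩), hfj,
      ← add_assoc (f i), ← h.ghost, ← add_assoc, h.add_self_add_self]
  have absorb_sum : ∀ t ⊆ s, ∑ i ∈ t, ν (f i) + ∑ j ∈ s, f j = ∑ j ∈ s, f j := by
    intro t
    induction t using Finset.induction_on with
    | empty => simp
    | insert a t ha ih =>
      intro hts
      rw [Finset.sum_insert ha, add_assoc, ih ((Finset.subset_insert a t).trans hts),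
        absorb a (hts (Finset.mem_insert_self a t))]
  have key := absorb_sum s subset_rfl
  rw [← h.map_sum, add_comm, h.add_map_self] at key
  exact ⟨_, key⟩

end IsSupertropical

namespace IsSupertropicalDomain

variable {R : Type*} [CommSemiring R] {ν : R → R}

theorem pow_notMem_range (h : IsSupertropicalDomain ν) {a : R} (ha : a ∉ Set.range ν) (m : ℕ) :
    a ^ m ∉ Set.range ν := by
  induction m with
  | zero => simpa using h.oneTangible
  | succ m ih => rw [pow_succ]; exact h.mulTangible _ _ ih ha

theorem exists_add_pow_eq {S : Type*} [CommSemiring S] (a b : S) {m : ℕ} (hm : m ≠ 0) :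
    ∃ r, (a + b) ^ m = a ^ m + b ^ m + r := by
  induction m with
  | zero => exact absurd rfl hm
  | succ m ih =>
    rcases eq_or_ne m 0 with rfl | hm'
    · exact ⟨0, by simp⟩
    · obtain ⟨r, hr⟩ := ih hm'
      exact ⟨a ^ m * b + b ^ m * a + r * (a + b), by rw [pow_succ, hr]; ring⟩

theorem eq_zero_of_pow_eq_zero (h : IsSupertropicalDomain ν) {a : R} {m : ℕ} (hm : m ≠ 0)
    (ha : ν (a ^ m) = 0) : a = 0 := by
  have hs := h.toIsSupertropical
  by_contra ha0
  obtain ⟨s, hs1, hs2⟩ := h.onto (ν a) ⟨a, rfl⟩ fun h0 => ha0 (hs.eq_zero_of_map_eq_zero h0)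
  refine h.pow_notMem_range hs1 m ⟨0, ?_⟩
  rw [hs.map_zero]
  refine (hs.eq_zero_of_map_eq_zero ?_).symm
  rw [hs.map_pow _ hm, hs2, ← hs.map_pow _ hm, ha]

theorem map_eq_of_map_pow_eq (h : IsSupertropicalDomain ν) {a b : R} {m : ℕ} (hm : m ≠ 0)
    (hab : ν (a ^ m) = ν (b ^ m)) : ν a = ν b := by
  have hs := h.toIsSupertropical
  by_cases ha : ν a = 0
  · rw [hs.map_pow _ hm, ha, zero_pow hm] at hab
    rw [ha, h.eq_zero_of_pow_eq_zero hm hab.symm, hs.map_zero]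
  by_cases hb : ν b = 0
  · rw [hs.map_pow b hm, hb, zero_pow hm] at hab
    rw [hb, h.eq_zero_of_pow_eq_zero hm hab, hs.map_zero]
  obtain ⟨s, hs1, hs2⟩ := h.onto (ν a) ⟨a, rfl⟩ ha
  obtain ⟨t, ht1, ht2⟩ := h.onto (ν b) ⟨b, rfl⟩ hb
  by_contra hne
  have hst : ν (s ^ m) = ν (t ^ m) := by
    rw [hs.map_pow _ hm, hs.map_pow _ hm, hs2, ht2, ← hs.map_pow _ hm, ← hs.map_pow _ hm, hab]
  obtain ⟨r, hr⟩ := exists_add_pow_eq s t hm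
  rw [hs.addEq _ _ hst] at hr
  have tangible : s + t ∉ Set.range ν := by
    rcases hs.addNe s t (by rwa [hs2, ht2]) with e | e <;> rwa [e]
  refine h.pow_notMem_range tangible m ⟨(s + t) ^ m, ?_⟩
  have hmap : ν ((s + t) ^ m) = ν (s ^ m) := by
    rcases hs.addNe s t (by rwa [hs2, ht2]) with e | e <;> rw [e]
    exact hst.symm
  rw [← hs.add_map_self, hmap]
  conv_rhs => rw [hr]
  rw [hr, add_right_comm, hs.add_self_add_self]

/-- The Frobenius identity for two summands. -/
theorem add_pow_eq (h : IsSupertropicalDomain ν) (a b : R) {m : ℕ} (hm : m ≠ 0) :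
    (a + b) ^ m = a ^ m + b ^ m := by
  have hs := h.toIsSupertropical
  have dominated : ∀ x y : R, ν x ≠ ν y → x + y = x → x ^ m + y ^ m = x ^ m := by
    intro x y hne hxy
    have hne' : ν (x ^ m) ≠ ν (y ^ m) := fun e => hne (h.map_eq_of_map_pow_eq hm e)
    rcases hs.addNe _ _ hne' with e | e
    · exact e
    · refine absurd ?_ hne'
      obtain ⟨r, hr⟩ := exists_add_pow_eq x y hm
      rw [hxy, e] at hr
      calc ν (x ^ m) = ν (y ^ m) + ν r := by rw [hr, hs.addMap]
        _ = ν (x ^ m + y ^ m) := by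
          rw [hs.addMap (x ^ m), hr, hs.addMap, add_right_comm, hs.add_self_add_self]
        _ = ν (y ^ m) := by rw [e]
  by_cases hab : ν a = ν b
  · have hab' : ν (a ^ m) = ν (b ^ m) := by rw [hs.map_pow _ hm, hs.map_pow _ hm, hab]
    rw [hs.addEq _ _ hab, hs.addEq _ _ hab', hs.map_pow _ hm]
  · rcases hs.addNe _ _ hab with e | e
    · rw [e, dominated a b hab e]
    · rw [e, add_comm, dominated b a (Ne.symm hab) (by rwa [add_comm])]

/-- The Frobenius identity for finite sums. -/
theorem sum_pow_eq (h : IsSupertropicalDomain ν) {ι : Type*} (s : Finset ι) (f : ι → R) {m : ℕ}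
    (hm : m ≠ 0) : (∑ i ∈ s, f i) ^ m = ∑ i ∈ s, f i ^ m := by
  classical
  induction s using Finset.induction_on with
  | empty => simp [hm]
  | insert a s ha ih => rw [Finset.sum_insert ha, Finset.sum_insert ha, h.add_pow_eq _ _ hm, ih]

end IsSupertropicalDomain

section Walks

variable {R : Type*} [CommSemiring R] {ι : Type*} [Fintype ι] [DecidableEq ι]

theorem pow_succ_apply_eq_sum_walks (B : Matrix ι ι R) (m : ℕ) (i j : ι) :
    (B ^ (m + 1)) i j = ∑ w : Fin m → ι, ∏ t : Fin (m + 1),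
      B (Fin.cons (α := fun _ => ι) i w t) (Fin.snoc (α := fun _ => ι) w j t) := by
  induction m generalizing i with
  | zero => simp [Fin.snoc]
  | succ m ih =>
    rw [pow_succ', Matrix.mul_apply, ← (Fin.consEquiv fun _ : Fin (m + 1) => ι).sum_comp,
      Fintype.sum_prod_type]
    refine Finset.sum_congr rfl fun l _ => ?_
    rw [ih, Finset.mul_sum]
    refine Finset.sum_congr rfl fun w _ => ?_
    change _ = ∏ t, B (Fin.cons (α := fun _ => ι) i (Fin.cons (α := fun _ => ι) l w) t)
      (Fin.snoc (α := fun _ => ι) (Fin.cons (α := fun _ => ι) l w) j t)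
    rw [← Fin.cons_snoc_eq_snoc_cons, Fin.prod_univ_succ (n := m + 1)]
    simp only [Fin.cons_zero, Fin.cons_succ]

theorem trace_pow_succ_eq_sum_closed_walks (B : Matrix ι ι R) (m : ℕ) :
    (B ^ (m + 1)).trace =
      ∑ v : Fin (m + 1) → ι, ∏ t, B (v t) (v (finRotate (m + 1) t)) := by
  rw [← (Fin.consEquiv fun _ : Fin (m + 1) => ι).sum_comp, Fintype.sum_prod_type]
  refine Finset.sum_congr rfl fun i _ => ?_
  rw [Matrix.diag_apply, pow_succ_apply_eq_sum_walks]
  refine Finset.sum_congr rfl fun w _ => ?_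
  simp only [Fin.snoc_eq_cons_rotate, Fin.consEquiv_apply]

theorem eq_const_of_comp_finRotate_eq {β : Type*} {m : ℕ} {v : Fin (m + 1) → β}
    (hv : v ∘ finRotate (m + 1) = v) (t : Fin (m + 1)) : v t = v 0 := by
  induction t using Fin.induction with
  | zero => rfl
  | succ t ih =>
    rw [← ih, ← congrFun hv t.castSucc]
    simp

/-- Closed walks which are not constant are repeated, up to rotation, in the trace of a power. -/
theorem exists_trace_pow_succ_eq {ν : R → R} (h : IsSupertropical ν) (B : Matrix ι ι R) (m : ℕ) :
    ∃ g ∈ h.ghostIdeal, (B ^ (m + 1)).trace = ∑ i, B i i ^ (m + 1) + g := by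
  rw [trace_pow_succ_eq_sum_closed_walks, ← Finset.sum_filter_add_sum_filter_not _
    fun v : Fin (m + 1) → ι => v ∘ finRotate (m + 1) = v]
  refine ⟨_, h.sum_mem_ghostIdeal _ _ ?_, congrArg (· + _) ?_⟩
  · intro v hv
    rw [Finset.mem_filter_univ] at hv
    refine ⟨v ∘ finRotate (m + 1), ?_, hv,
      Equiv.prod_comp (finRotate (m + 1)) fun t => B (v t) (v (finRotate (m + 1) t))⟩
    rw [Finset.mem_filter_univ]
    exact fun e => hv ((finRotate (m + 1)).surjective.injective_comp_right e)
  · refine (Finset.sum_nbij' (fun i _ => i) (fun v => v 0) ?_ ?_ ?_ ?_ ?_).symm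
    · intro i _
      simp [Function.comp_def]
    · simp
    · simp
    · intro v hv
      rw [Finset.mem_filter_univ] at hv
      exact funext fun t => (eq_const_of_comp_finRotate_eq hv t).symm
    · simp

end Walks

section Compound

variable {R : Type*} [CommSemiring R] {α : Type*} [Fintype α] [DecidableEq α]

/-- The `k`-th permanental compound of a matrix: its entries are the permanents of the
`k × k` submatrices. -/
def permanentalCompound (k : ℕ) (A : Matrix α α R) :
    Matrix {S : Finset α // S.card = k} {S : Finset α // S.card = k} R :=
  Matrix.of fun S T => ∑ e : S.1 ≃ T.1, ∏ i : S.1, A i (e i)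

/-- An injective map on `S` amounts to a bijection from `S` to a set of the same cardinality. -/
theorem sum_injective_eq_sum_equiv {k : ℕ} (S : {S : Finset α // S.card = k})
    (F : (S.1 → α) → R) :
    ∑ f with Function.Injective f, F f =
      ∑ U : {S : Finset α // S.card = k}, ∑ e : S.1 ≃ U.1, F fun i => e i := by
  rw [← Fintype.sum_sigma']
  refine (Finset.sum_bij (fun p _ i => (p.2 i : α)) ?_ ?_ ?_ fun _ _ => rfl).symm
  · rintro ⟨U, e⟩ -
    rw [Finset.mem_filter_univ]
    exact Subtype.val_injective.comp e.injective
  · rintro ⟨⟨U, hU⟩, e⟩ - ⟨⟨V, hV⟩, e'⟩ - hee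
    have hUV : U = V := by
      ext x
      constructor
      · intro hx
        have := congrFun hee (e.symm ⟨x, hx⟩)
        simp only [Equiv.apply_symm_apply] at this
        rw [this]
        exact Subtype.property _
      · intro hx
        have := congrFun hee (e'.symm ⟨x, hx⟩)
        simp only [Equiv.apply_symm_apply] at this
        rw [← this]
        exact Subtype.property _
    subst hUV
    congr 1
    ext i
    exact congrFun hee i
  · intro f hf
    rw [Finset.mem_filter_univ] at hf
    refine ⟨⟨⟨Finset.univ.image f, ?_⟩, Equiv.ofBijective
      (fun i => ⟨f i, Finset.mem_image_of_mem f (Finset.mem_univ i)⟩) ⟨?_, ?_⟩⟩,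
      Finset.mem_univ _, ?_⟩
    · rw [Finset.card_image_of_injective _ hf]
      simpa using S.2
    · intro i j hij
      exact hf (congrArg Subtype.val hij)
    · rintro ⟨x, hx⟩
      obtain ⟨i, -, rfl⟩ := Finset.mem_image.1 hx
      exact ⟨i, rfl⟩
    · rfl

theorem exists_permanentalCompound_mul {ν : R → R} (h : IsSupertropical ν) (k : ℕ)
    (A B : Matrix α α R) (S T : {S : Finset α // S.card = k}) :
    ∃ g ∈ h.ghostIdeal, permanentalCompound k (A * B) S T =
      (permanentalCompound k A * permanentalCompound k B) S T + g := by
  have expand : permanentalCompound k (A * B) S T =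
      ∑ f : S.1 → α, ∑ e : S.1 ≃ T.1, ∏ i : S.1, (A i (f i) * B (f i) (e i)) := by
    simp only [permanentalCompound, Matrix.of_apply, Matrix.mul_apply, Fintype.prod_sum]
    exact Finset.sum_comm
  rw [expand, ← Finset.sum_filter_add_sum_filter_not _ fun f : S.1 → α => Function.Injective f]
  refine ⟨_, sum_mem fun f hf => ?_, congrArg (· + _) ?_⟩
  · rw [Finset.mem_filter_univ] at hf
    simp only [Function.Injective, not_forall] at hf
    obtain ⟨i, j, hij, hne⟩ := hf
    refine h.sum_mem_ghostIdeal _ _ fun e _ =>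
      ⟨(Equiv.swap i j).trans e, Finset.mem_univ _, ?_, ?_⟩
    · intro he
      have := Equiv.congr_fun he i
      simp only [Equiv.trans_apply, Equiv.swap_apply_left, EmbeddingLike.apply_eq_iff_eq] at this
      exact hne this.symm
    · have hf : ∀ x, f (Equiv.swap i j x) = f x := by
        intro x
        rw [Equiv.swap_apply_def]
        split_ifs with h1 h2
        · rw [h1, hij]
        · rw [h2, hij]
        · rfl
      simp only [Finset.prod_mul_distrib]
      congr 1
      rw [← Equiv.prod_comp (Equiv.swap i j) fun x => B (f x) (e x)]
      simp only [hf, Equiv.trans_apply]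
  · rw [sum_injective_eq_sum_equiv S fun f =>
      ∑ e : S.1 ≃ T.1, ∏ i : S.1, (A i (f i) * B (f i) (e i)), Matrix.mul_apply]
    refine Finset.sum_congr rfl fun U _ => ?_
    simp only [permanentalCompound, Matrix.of_apply, Finset.sum_mul_sum]
    refine Finset.sum_congr rfl fun p _ => ?_
    refine Fintype.sum_equiv (p.equivCongr (Equiv.refl _)) _ _ fun e => ?_
    rw [Finset.prod_mul_distrib, ← p.prod_comp fun u =>
      B u (p.equivCongr (Equiv.refl _) e u)]
    simp

theorem exists_permanentalCompound_pow {ν : R → R} (h : IsSupertropical ν) (k : ℕ)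
    (A : Matrix α α R) (m : ℕ) (S T : {S : Finset α // S.card = k}) :
    ∃ g ∈ h.ghostIdeal, permanentalCompound k (A ^ (m + 1)) S T =
      (permanentalCompound k A ^ (m + 1)) S T + g := by
  induction m generalizing T with
  | zero => exact ⟨0, zero_mem _, by simp⟩
  | succ m ih =>
    choose g hg hgeq using ih
    obtain ⟨g', hg', heq⟩ := exists_permanentalCompound_mul h k (A ^ (m + 1)) A S T
    refine ⟨∑ U, g U * permanentalCompound k A U T + g',
      add_mem (sum_mem fun U _ => Ideal.mul_mem_right _ _ (hg U)) hg', ?_⟩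
    rw [pow_succ A, heq, pow_succ (permanentalCompound k A), Matrix.mul_apply, Matrix.mul_apply,
      ← add_assoc, ← Finset.sum_add_distrib]
    simp only [hgeq, add_mul]

/-- The coefficients of the characteristic polynomial are the sums of the principal minors. -/
theorem stCharPoly_coeff (A : Matrix α α R) {k : ℕ} (hk : k ≤ Fintype.card α) :
    (stCharPoly A).coeff (Fintype.card α - k) = (permanentalCompound k A).trace := by
  have term : ∀ (σ : Equiv.Perm α) (S : Finset α),
      ((∏ i ∈ S, Polynomial.C (A i (σ i))) *
        ∏ i ∈ Sᶜ, if i = σ i then Polynomial.X else 0).coeff (Fintype.card α - k) =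
      if S.card = k then if ∀ i, i ∉ S → σ i = i then ∏ i ∈ S, A i (σ i) else 0 else 0 := by
    intro σ S
    rw [← map_prod, mul_comm]
    by_cases hσ : ∀ i, i ∉ S → σ i = i
    · rw [if_pos hσ, Finset.prod_congr rfl fun i hi =>
        if_pos (hσ i (Finset.mem_compl.1 hi)).symm, Finset.prod_const, Finset.card_compl,
        Polynomial.coeff_mul_C, Polynomial.coeff_X_pow]
      have := S.card_le_univ
      have : Fintype.card α - k = Fintype.card α - S.card ↔ S.card = k := by omega
      simp [this]
    · rw [if_neg hσ]
      push Not at hσ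
      obtain ⟨i, hi, hne⟩ := hσ
      rw [Finset.prod_eq_zero (Finset.mem_compl.2 hi) (if_neg (Ne.symm hne))]
      simp
  have restrict : ∀ S : Finset α,
      (∑ σ : Equiv.Perm α, if ∀ i, i ∉ S → σ i = i then ∏ i ∈ S, A i (σ i) else 0) =
        ∑ e : Equiv.Perm S, ∏ i : S, A i (e i) := by
    intro S
    rw [← Finset.sum_filter, ← Finset.sum_subtype_eq_sum_filter, Finset.subtype_univ]
    refine (Fintype.sum_equiv (Equiv.Perm.subtypeEquivSubtypePerm (· ∈ S)) _ _ fun e => ?_).symm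
    refine (Finset.prod_congr rfl fun i _ => ?_).trans
      (Finset.prod_coe_sort S fun i => A i (Equiv.Perm.ofSubtype e i))
    rw [Equiv.Perm.ofSubtype_apply_coe]
  simp only [stCharPoly, add_comm _ (Polynomial.C _), Fintype.prod_add,
    Polynomial.finsetSum_coeff, term]
  rw [Finset.sum_comm]
  calc _ = ∑ S : Finset α, if S.card = k then ∑ e : Equiv.Perm S, ∏ i : S, A i (e i) else 0 := by
        refine Finset.sum_congr rfl fun S _ => ?_
        split_ifs
        · exact restrict S
        · exact Finset.sum_const_zero
    _ = _ := by
        rw [← Finset.sum_filter]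
        exact Finset.sum_subtype _ (fun S => Finset.mem_filter_univ S) _

end Compound

/-- Theorem 4.2: writing `f_A = λ^n + Σ_{k=1}^n α_k λ^{n-k}`, for every
`m ≥ 1` and `0 ≤ k ≤ n`, the coefficient of `λ^{n-k}` in the characteristic polynomial of
`A^m` ghost-surpasses `α_k^m` (with `α_0 = 1`). -/
theorem charPoly_pow_coeff_ghost_surpasses {R : Type*} [CommSemiring R] (ν : R → R)
    (hST : IsSupertropicalDomain ν) {n : ℕ} (A : Matrix (Fin n) (Fin n) R)
    (m : ℕ) (hm : 1 ≤ m) (k : ℕ) (hk : k ≤ n) :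
    ∃ g ∈ Set.range ν,
      (stCharPoly (A ^ m)).coeff (n - k) = ((stCharPoly A).coeff (n - k)) ^ m + g := by
  have hs := hST.toIsSupertropical
  obtain ⟨m, rfl⟩ := Nat.exists_eq_succ_of_ne_zero (Nat.one_le_iff_ne_zero.1 hm)
  have hcoeff (B : Matrix (Fin n) (Fin n) R) :
      (stCharPoly B).coeff (n - k) = (permanentalCompound k B).trace := by
    simpa using stCharPoly_coeff B (k := k) (by simpa using hk)
  obtain ⟨g, hg, htrace⟩ := exists_trace_pow_succ_eq hs (permanentalCompound k A) m
  choose g' hg' hpow using fun S => exists_permanentalCompound_pow hs k A m S S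
  refine ⟨g + ∑ S, g' S, hs.mem_ghostIdeal.1 (add_mem hg (sum_mem fun S _ => hg' S)), ?_⟩
  rw [hcoeff, hcoeff, Matrix.trace, Matrix.trace, hST.sum_pow_eq _ _ m.succ_ne_zero, ← add_assoc]
  simp only [Matrix.diag_apply]
  rw [← htrace, Matrix.trace, ← Finset.sum_add_distrib]
  exact Finset.sum_congr rfl fun S _ => hpow S
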